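/- arXiv:2205.00450 — 2 statements merged into one kernel-verified Lean document; each statement's English description precedes it below -/
import Mathlib

section
/- For every multi-issue bankruptcy problem with crossed claims (I, N, E, c, α), the constrained random arrival allocation CRA(I,N,E,c,α), defined as the average over all |N|! orders σ of the constrained sequential priority allocations CSP^σ, is a feasible allocation: 0 ≤ CRA_j ≤ c_j for every claimant j, and ∑_{j : i ∈ α(j)} CRA_j ≤ e_i for every issue i. -/
open Finset

/-- The constrained sequential priority allocation `CSP^σ` of a multi-issue bankruptcy
problem with crossed claims, defined recursively in increasing `σ`-order:
`CSP^σ_j = min (c j) (max 0 (min_{i ∈ α j} (e i - ∑_{k : i ∈ α k, σ k < σ j} CSP^σ_k)))`.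
The minimum over the (nonempty) finite set `α j` is expressed via `sInf`. -/
noncomputable def CSP {I N : Type*} [Fintype I] [Fintype N] [DecidableEq I] [DecidableEq N]
    (e : I → ℝ) (c : N → ℝ) (α : N → Finset I) (σ : N → ℕ) (j : N) : ℝ :=
  min (c j)
    (max 0 (sInf (↑((α j).image fun i =>
      e i - ∑ k ∈ (Finset.univ.filter fun k => i ∈ α k ∧ σ k < σ j).attach,
        CSP e c α σ k.1) : Set ℝ)))
termination_by σ j
decreasing_by
  have hk := k.2
  simp only [Finset.mem_filter, Finset.mem_univ, true_and] at hk
  exact hk.2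

/-- `(I, N, E, c, α)` is a multi-issue bankruptcy problem with crossed claims. -/
def IsMBC {I N : Type*} [Fintype I] [Fintype N] [DecidableEq I] [DecidableEq N]
    (e : I → ℝ) (c : N → ℝ) (α : N → Finset I) : Prop :=
  Nonempty I ∧ Nonempty N ∧ (∀ i, 0 ≤ e i) ∧ (∀ j, 0 ≤ c j) ∧ (∀ j, (α j).Nonempty) ∧
    ∀ i, e i < ∑ j ∈ Finset.univ.filter (fun j => i ∈ α j), c j

/-- `x` is a feasible allocation of the problem `(I, N, E, c, α)`. -/
def Feasible {I N : Type*} [Fintype I] [Fintype N] [DecidableEq I] [DecidableEq N]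
    (e : I → ℝ) (c : N → ℝ) (α : N → Finset I) (x : N → ℝ) : Prop :=
  (∀ j, 0 ≤ x j) ∧ (∀ j, x j ≤ c j) ∧
    ∀ i, ∑ j ∈ Finset.univ.filter (fun j => i ∈ α j), x j ≤ e i

/-- `x` is Pareto efficient: no feasible allocation weakly dominates it with a strict gain. -/
def ParetoEff {I N : Type*} [Fintype I] [Fintype N] [DecidableEq I] [DecidableEq N]
    (e : I → ℝ) (c : N → ℝ) (α : N → Finset I) (x : N → ℝ) : Prop :=
  ¬ ∃ a : N → ℝ, Feasible e c α a ∧ (∀ j, x j ≤ a j) ∧ ∃ j, x j < a j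

/-- The constrained random arrival rule: the average over all `|N|!` orders
(bijections `N ≃ Fin |N|`) of the constrained sequential priority allocations. -/
noncomputable def CRA {I N : Type*} [Fintype I] [Fintype N] [DecidableEq I] [DecidableEq N]
    (e : I → ℝ) (c : N → ℝ) (α : N → Finset I) (j : N) : ℝ :=
  (∑ σ : N ≃ Fin (Fintype.card N), CSP e c α (fun k => (σ k : ℕ)) j) /
    (Nat.factorial (Fintype.card N) : ℝ)

theorem CSP_nonneg {I N : Type*} [Fintype I] [Fintype N] [DecidableEq I] [DecidableEq N]
    (e : I → ℝ) (c : N → ℝ) (α : N → Finset I) (σ : N → ℕ) (hc : ∀ j, 0 ≤ c j) (j : N) :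
    0 ≤ CSP e c α σ j := by
  rw [CSP]
  exact le_min (hc j) (le_max_left _ _)

theorem CSP_le_claim {I N : Type*} [Fintype I] [Fintype N] [DecidableEq I] [DecidableEq N]
    (e : I → ℝ) (c : N → ℝ) (α : N → Finset I) (σ : N → ℕ) (j : N) :
    CSP e c α σ j ≤ c j := by
  rw [CSP]
  exact min_le_left _ _

theorem CSP_le_rest {I N : Type*} [Fintype I] [Fintype N] [DecidableEq I] [DecidableEq N]
    (e : I → ℝ) (c : N → ℝ) (α : N → Finset I) (σ : N → ℕ) (j : N) (i : I) (hi : i ∈ α j) :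
    CSP e c α σ j ≤ max 0 (e i - ∑ k ∈ Finset.univ.filter (fun k => i ∈ α k ∧ σ k < σ j),
      CSP e c α σ k) := by
  rw [CSP]
  refine (min_le_right _ _).trans (max_le_max le_rfl ?_)
  refine csInf_le (Finset.bddBelow _) ?_
  rw [Finset.mem_coe, Finset.mem_image]
  exact ⟨i, hi, by rw [Finset.sum_attach _ (fun k => CSP e c α σ k)]⟩

theorem CSP_partial {I N : Type*} [Fintype I] [Fintype N] [DecidableEq I] [DecidableEq N]
    (e : I → ℝ) (c : N → ℝ) (α : N → Finset I) (σ : N → ℕ) (hσ : Function.Injective σ)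
    (i : I) (he : 0 ≤ e i) (m : ℕ) :
    ∑ k ∈ Finset.univ.filter (fun k => i ∈ α k ∧ σ k < m), CSP e c α σ k ≤ e i := by
  induction m with
  | zero => simpa using he
  | succ m ih =>
    by_cases h : ∃ j, i ∈ α j ∧ σ j = m
    · obtain ⟨j, hj, rfl⟩ := h
      have hs : Finset.univ.filter (fun k => i ∈ α k ∧ σ k < σ j + 1) =
          insert j (Finset.univ.filter (fun k => i ∈ α k ∧ σ k < σ j)) := by
        ext k
        simp only [Finset.mem_filter, Finset.mem_univ, true_and, Finset.mem_insert]
        constructor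
        · rintro ⟨h1, h2⟩
          rcases Nat.lt_succ_iff_lt_or_eq.mp h2 with h3 | h3
          · exact Or.inr ⟨h1, h3⟩
          · exact Or.inl (hσ h3)
        · rintro (rfl | ⟨h1, h2⟩)
          · exact ⟨hj, Nat.lt_succ_self _⟩
          · exact ⟨h1, by omega⟩
      rw [hs, Finset.sum_insert (by simp)]
      have h1 := CSP_le_rest e c α σ j i hj
      rw [max_eq_right (by linarith)] at h1
      linarith
    · have hs : Finset.univ.filter (fun k => i ∈ α k ∧ σ k < m + 1) =
          Finset.univ.filter (fun k => i ∈ α k ∧ σ k < m) := by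
        ext k
        simp only [Finset.mem_filter, Finset.mem_univ, true_and]
        constructor
        · rintro ⟨h1, h2⟩
          have : σ k ≠ m := fun h3 => h ⟨k, h1, h3⟩
          exact ⟨h1, by omega⟩
        · rintro ⟨h1, h2⟩
          exact ⟨h1, by omega⟩
      rw [hs]
      exact ih

/-- For every MBC problem, the constrained random arrival allocation `CRA`
(the average over all `|N|!` orders of the `CSP^σ` allocations) is a feasible allocation. -/
theorem CRA_feasible {I N : Type*} [Fintype I] [Fintype N] [DecidableEq I] [DecidableEq N]
    (e : I → ℝ) (c : N → ℝ) (α : N → Finset I) (hMBC : IsMBC e c α) :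
    Feasible e c α (CRA e c α) := by
  obtain ⟨-, -, he, hc, -, -⟩ := hMBC
  have hpos : (0 : ℝ) < (Nat.factorial (Fintype.card N) : ℝ) := by
    exact_mod_cast Nat.factorial_pos _
  have hcard : (Fintype.card (N ≃ Fin (Fintype.card N)) : ℝ) =
      (Nat.factorial (Fintype.card N) : ℝ) := by
    rw [Fintype.card_equiv (Fintype.equivFin N)]
  have avg : ∀ (f : (N ≃ Fin (Fintype.card N)) → ℝ) (b : ℝ), (∀ σ, f σ ≤ b) →
      (∑ σ, f σ) / (Nat.factorial (Fintype.card N) : ℝ) ≤ b := by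
    intro f b hf
    rw [div_le_iff₀ hpos, ← hcard]
    refine (Finset.sum_le_sum (fun σ _ => hf σ)).trans (le_of_eq ?_)
    rw [Finset.sum_const, Finset.card_univ, nsmul_eq_mul, mul_comm]
  refine ⟨fun j => ?_, fun j => ?_, fun i => ?_⟩
  · exact div_nonneg (Finset.sum_nonneg fun σ _ => CSP_nonneg e c α _ hc j) hpos.le
  · exact avg _ _ fun σ => CSP_le_claim e c α _ j
  · simp only [CRA]
    rw [← Finset.sum_div, Finset.sum_comm]
    refine avg _ _ fun σ => ?_
    have h := CSP_partial e c α (fun k => (σ k : ℕ))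
      (fun a b hab => σ.injective (Fin.ext hab)) i (he i) (Fintype.card N)
    simpa using h
end

section
/- Swap lemma for equal claimants: let (I, N, E, c, α) be a multi-issue bankruptcy problem with crossed claims, let j, k ∈ N be equal claimants (α(j) = α(k) and c_j = c_k), let σ be an order on N, and let σ' = σ ∘ τ where τ is the transposition of j and k. Then CSP^{σ'}_j = CSP^σ_k, CSP^{σ'}_k = CSP^σ_j, and CSP^{σ'}_h = CSP^σ_h for every claimant h ∉ {j,k}. -/
open Finset

theorem CSP_comp_perm {I N : Type*} [Fintype I] [Fintype N] [DecidableEq I] [DecidableEq N]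
    (e : I → ℝ) (c : N → ℝ) (α : N → Finset I) (s : N → ℕ) (τ : Equiv.Perm N)
    (hα : ∀ x, α (τ x) = α x) (hc : ∀ x, c (τ x) = c x) :
    ∀ (n : ℕ) (x : N), s (τ x) = n →
      CSP e c α (fun y => s (τ y)) x = CSP e c α s (τ x) := by
  intro n
  induction n using Nat.strong_induction_on with
  | _ n ih =>
    intro x hx
    have key : ∀ i : I,
        ∑ k ∈ (Finset.univ.filter fun k => i ∈ α k ∧ s (τ k) < s (τ x)),
          CSP e c α (fun y => s (τ y)) k =
        ∑ k ∈ (Finset.univ.filter fun k => i ∈ α k ∧ s k < s (τ x)), CSP e c α s k := by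
      intro i
      refine Finset.sum_equiv τ ?_ ?_
      · intro k
        simp [hα]
      · intro k hk
        simp only [Finset.mem_filter, Finset.mem_univ, true_and] at hk
        exact ih (s (τ k)) (hx ▸ hk.2) k rfl
    rw [CSP, CSP, hα, hc]
    have e1 : ∀ i : I, _ := fun i => Finset.sum_attach
      (Finset.univ.filter fun k => i ∈ α k ∧ s (τ k) < s (τ x)) (CSP e c α (fun y => s (τ y)))
    have e2 : ∀ i : I, _ := fun i => Finset.sum_attach
      (Finset.univ.filter fun k => i ∈ α k ∧ s k < s (τ x)) (CSP e c α s)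
    simp only [e1, e2, key]

/-- swap lemma for equal claimants.  If `j, k` are equal claimants
(`α j = α k`, `c j = c k`) and `σ' = σ ∘ τ` with `τ` the transposition of `j` and `k`,
then `CSP^{σ'}_j = CSP^σ_k`, `CSP^{σ'}_k = CSP^σ_j`, and `CSP^{σ'}_h = CSP^σ_h`
for every `h ∉ {j, k}`. -/
theorem CSP_swap_equal_claimants {I N : Type*}
    [Fintype I] [Fintype N] [DecidableEq I] [DecidableEq N]
    (e : I → ℝ) (c : N → ℝ) (α : N → Finset I) (hMBC : IsMBC e c α)
    (j k : N) (hhom : α j = α k) (hc : c j = c k)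
    (σ : N ≃ Fin (Fintype.card N)) :
    CSP e c α (fun x => (((Equiv.swap j k).trans σ) x : ℕ)) j
        = CSP e c α (fun x => (σ x : ℕ)) k ∧
    CSP e c α (fun x => (((Equiv.swap j k).trans σ) x : ℕ)) k
        = CSP e c α (fun x => (σ x : ℕ)) j ∧
    ∀ h : N, h ≠ j → h ≠ k →
      CSP e c α (fun x => (((Equiv.swap j k).trans σ) x : ℕ)) h
        = CSP e c α (fun x => (σ x : ℕ)) h := by
  have hα : ∀ x, α (Equiv.swap j k x) = α x := by
    intro x
    rw [Equiv.swap_apply_def]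
    split_ifs with h1 h2
    · rw [h1, hhom]
    · rw [h2, hhom]
    · rfl
  have hc' : ∀ x, c (Equiv.swap j k x) = c x := by
    intro x
    rw [Equiv.swap_apply_def]
    split_ifs with h1 h2
    · rw [h1, hc]
    · rw [h2, hc]
    · rfl
  have main := fun x => CSP_comp_perm e c α (fun x => (σ x : ℕ)) (Equiv.swap j k) hα hc' _ x rfl
  refine ⟨?_, ?_, ?_⟩
  · simpa using main j
  · simpa using main k
  · intro h hj hk
    have := main h
    rw [Equiv.swap_apply_of_ne_of_ne hj hk] at this
    exact this
end
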